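/- arXiv:1212.3789 — 2 statements merged into one kernel-verified Lean document; each statement's English description precedes it below -/
import Mathlib

section
/- Variation of a transported integral with respect to the transformation (interior version of Lemma 3.2): Let Ω ⊆ ℝ^d be a bounded open set, let Φ : ℝ^d → ℝ^d, y : ℝ^d → ℝ, λ : ℝ^d → ℝ be C^∞ maps, and assume DΦ(x) is invertible for every x in the closure of Ω. Let ψ : ℝ^d → ℝ^d be a C^∞ map whose support is compact and contained in Ω. Then the function s ↦ ∫_Ω y(x) · λ((Φ + s·ψ)(x)) · det(D(Φ + s·ψ)(x)) dx is differentiable at s = 0, and its derivative at 0 equals −∫_Ω det(DΦ(x)) · ⟨(DΦ(x))⁻ᵀ ∇y(x), ψ(x)⟩ · λ(Φ(x)) dx. -/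
open Matrix MeasureTheory

/-- The Jacobian matrix of a map `Φ : ℝ^d → ℝ^d` at `x`: entry `(i, j)` is the partial
derivative of the `i`-th component of `Φ` in the `j`-th coordinate direction. -/
noncomputable def jacobianMatrix {d : ℕ} (Φ : (Fin d → ℝ) → (Fin d → ℝ))
    (x : Fin d → ℝ) : Matrix (Fin d) (Fin d) ℝ :=
  Matrix.of fun i j => fderiv ℝ Φ x (Pi.single j 1) i

/-- The gradient of a scalar function `y : ℝ^d → ℝ` at `x`. -/
noncomputable def grad {d : ℕ} (y : (Fin d → ℝ) → ℝ) (x : Fin d → ℝ) : Fin d → ℝ :=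
  fun i => fderiv ℝ y x (Pi.single i 1)

namespace Matrix

section DetDerivative

variable {n E : Type*} [Fintype n] [DecidableEq n] [NormedAddCommGroup E] [NormedSpace ℝ E]

/-- The determinant as a continuous multilinear function of the rows of a real matrix. -/
noncomputable def detRowContinuousMultilinear :
    ContinuousMultilinearMap ℝ (fun _ : n => n → ℝ) ℝ where
  toMultilinearMap := (detRowAlternating (n := n) (R := ℝ)).toMultilinearMap
  cont := Continuous.matrix_det (A := fun v : n → n → ℝ => Matrix.of v) continuous_id

theorem hasFDerivAt_det {A : E → Matrix n n ℝ} {A' : n → E →L[ℝ] (n → ℝ)} {x : E}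
    (hA : ∀ i, HasFDerivAt (fun z => A z i) (A' i) x) :
    HasFDerivAt (fun z => (A z).det)
      (∑ i, detRowContinuousMultilinear.toContinuousLinearMap (fun j => A x j) i ∘L A' i) x :=
  HasFDerivAt.multilinear_comp (f := detRowContinuousMultilinear) hA

theorem fderiv_det_apply {A : E → Matrix n n ℝ} {x : E}
    (hA : ∀ i, DifferentiableAt ℝ (fun z => A z i) x) (v : E) :
    fderiv ℝ (fun z => (A z).det) x v =
      ∑ i, ((A x).updateRow i (fderiv ℝ (fun z => A z i) x v)).det := by
  rw [(hasFDerivAt_det fun i => (hA i).hasFDerivAt).fderiv, _root_.sum_apply]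
  rfl

theorem hasDerivAt_det_add_smul (A B : Matrix n n ℝ) :
    HasDerivAt (fun s : ℝ => (A + s • B).det) (∑ i, (A.updateRow i (B i)).det) 0 := by
  have h := (hasFDerivAt_det (A := fun s : ℝ => A + s • B) (x := 0) fun i =>
    (((hasDerivAt_id (0 : ℝ)).smul_const (B i)).const_add (A i)).hasFDerivAt).hasDerivAt
  convert h using 1
  rw [_root_.sum_apply]
  refine Finset.sum_congr rfl fun i _ => ?_
  change _ = det (updateRow (A + (0 : ℝ) • B) i _)
  simp

theorem contDiff_det {k : WithTop ℕ∞} {A : E → Matrix n n ℝ}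
    (hA : ∀ i j, ContDiff ℝ k fun z => A z i j) : ContDiff ℝ k fun z => (A z).det := by
  simp only [det_apply, Units.smul_def, zsmul_eq_mul]
  exact ContDiff.sum fun σ _ => contDiff_const.mul (contDiff_prod fun i _ => hA _ _)

theorem contDiff_adjugate_apply {k : WithTop ℕ∞} {A : E → Matrix n n ℝ}
    (hA : ∀ i j, ContDiff ℝ k fun z => A z i j) (i j : n) :
    ContDiff ℝ k fun z => (A z).adjugate i j := by
  simp only [adjugate_apply]
  refine contDiff_det fun a b => ?_
  by_cases h : a = j
  · simpa [updateRow_apply, h] using contDiff_const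
  · simpa [updateRow_apply, h] using hA a b

end DetDerivative

section Determinant

variable {n R : Type*} [Fintype n] [DecidableEq n] [CommRing R]

theorem det_updateRow_eq_sum_adjugate (A : Matrix n n R) (i : n) (v : n → R) :
    (A.updateRow i v).det = ∑ j, A.adjugate j i * v j := by
  rw [← cramer_transpose_apply, cramer_eq_adjugate_mulVec, ← adjugate_transpose]
  rfl

theorem det_updateRow_updateRow_swap (A : Matrix n n R) {i k : n} (hik : i ≠ k) (u v : n → R) :
    ((A.updateRow i u).updateRow k v).det = -((A.updateRow i v).updateRow k u).det := by
  have h : ((A.updateRow i (u + v)).updateRow k (u + v)).det = 0 :=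
    det_zero_of_row_eq hik (by ext; simp [updateRow_apply, hik])
  have hself (w : n → R) : ((A.updateRow i w).updateRow k w).det = 0 :=
    det_zero_of_row_eq hik (by ext; simp [updateRow_apply, hik])
  rw [det_updateRow_add, updateRow_comm _ hik, det_updateRow_add, updateRow_comm _ hik (u + v),
    det_updateRow_add, updateRow_comm _ hik.symm, updateRow_comm _ hik.symm,
    updateRow_comm _ hik.symm, updateRow_comm _ hik.symm, hself, hself] at h
  linear_combination h

/-- Contracting the symmetric array `H` against two distinct rows of a determinant gives zero. -/
theorem sum_det_updateRow_single_eq_zero [IsAddTorsionFree R]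
    (A : Matrix n n R) {i k : n} (hik : i ≠ k) (H : n → n → R) (hH : ∀ j l, H j l = H l j) :
    ∑ j, ((A.updateRow i (Pi.single j 1)).updateRow k (H j)).det = 0 := by
  have hexp (j : n) : ((A.updateRow i (Pi.single j 1)).updateRow k (H j)).det =
      ∑ l, H j l * ((A.updateRow i (Pi.single j 1)).updateRow k (Pi.single l 1)).det := by
    simp only [det_updateRow_eq_sum_adjugate _ k, Pi.single_apply]
    simp [mul_comm]
  rw [← self_eq_neg]
  simp only [hexp]
  refine Finset.sum_comm.trans ?_
  rw [← Finset.sum_neg_distrib]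
  refine Finset.sum_congr rfl fun l _ => ?_
  rw [← Finset.sum_neg_distrib]
  refine Finset.sum_congr rfl fun j _ => ?_
  rw [det_updateRow_updateRow_swap A hik, hH, mul_neg]

end Determinant

end Matrix

section Piola

variable {d : ℕ} {Φ : (Fin d → ℝ) → (Fin d → ℝ)}

theorem contDiff_jacobianMatrix_apply (hΦ : ContDiff ℝ (⊤ : ℕ∞) Φ) (i j : Fin d) :
    ContDiff ℝ (⊤ : ℕ∞) fun x => jacobianMatrix Φ x i j :=
  contDiff_pi.1 ((hΦ.fderiv_right (m := (⊤ : ℕ∞)) (by simp)).clm_apply contDiff_const) i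

theorem fderiv_jacobianMatrix_apply (hΦ : ContDiff ℝ (⊤ : ℕ∞) Φ) (x v : Fin d → ℝ)
    (i j : Fin d) :
    fderiv ℝ (fun z => jacobianMatrix Φ z i j) x v =
      fderiv ℝ (fderiv ℝ Φ) x v (Pi.single j 1) i := by
  have h : DifferentiableAt ℝ (fderiv ℝ Φ) x :=
    (hΦ.fderiv_right (m := (⊤ : ℕ∞)) (by simp)).differentiable (by simp) x
  have h' := hasFDerivAt_pi'.1 (h.hasFDerivAt.clm_apply (hasFDerivAt_const (Pi.single j 1) x)) i
  change fderiv ℝ (fun z => fderiv ℝ Φ z (Pi.single j 1) i) x v = _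
  rw [h'.fderiv]
  simp

/-- **Piola identity**: the columns of the cofactor matrix of a Jacobian matrix are
divergence-free. -/
theorem sum_fderiv_adjugate_jacobianMatrix (hΦ : ContDiff ℝ (⊤ : ℕ∞) Φ) (x : Fin d → ℝ)
    (i : Fin d) :
    ∑ j, fderiv ℝ (fun z => (jacobianMatrix Φ z).adjugate j i) x (Pi.single j 1) = 0 := by
  have hrow (k : Fin d) : DifferentiableAt ℝ (fun z => jacobianMatrix Φ z k) x :=
    differentiableAt_pi.2 fun j =>
      (contDiff_jacobianMatrix_apply hΦ k j).differentiable (by simp) x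
  have hupd (j k : Fin d) : (fun z => (jacobianMatrix Φ z).updateRow i (Pi.single j 1) k) =
      if k = i then fun _ => Pi.single j 1 else fun z => jacobianMatrix Φ z k := by
    split_ifs with h
    · simp [h]
    · ext1 z
      simp [h]
  have hdiff (j k : Fin d) : DifferentiableAt ℝ
      (fun z => (jacobianMatrix Φ z).updateRow i (Pi.single j 1) k) x := by
    rw [hupd]
    split_ifs
    exacts [differentiableAt_const _, hrow k]
  simp only [adjugate_apply]
  simp_rw [fderiv_det_apply (hdiff _)]
  rw [Finset.sum_comm]
  refine Finset.sum_eq_zero fun k _ => ?_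
  by_cases h : k = i
  · refine Finset.sum_eq_zero fun j _ => det_eq_zero_of_row_eq_zero k fun l => ?_
    rw [hupd, if_pos h]
    simp
  · simp only [hupd, if_neg h]
    refine sum_det_updateRow_single_eq_zero _ (Ne.symm h)
      (fun j => fderiv ℝ (fun z => jacobianMatrix Φ z k) x (Pi.single j 1)) fun j l => ?_
    have hentry (a b : Fin d) : fderiv ℝ (fun z => jacobianMatrix Φ z k) x (Pi.single a 1) b =
        fderiv ℝ (fderiv ℝ Φ) x (Pi.single a 1) (Pi.single b 1) k := by
      rw [← fderiv_jacobianMatrix_apply hΦ,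
        (hasFDerivAt_pi'.1 (hrow k).hasFDerivAt b).fderiv]
      rfl
    have hsmooth : minSmoothness ℝ 2 ≤ ((⊤ : ℕ∞) : WithTop ℕ∞) := by
      rw [minSmoothness_of_isRCLikeNormedField]
      exact WithTop.coe_le_coe.2 (le_top : (2 : ℕ∞) ≤ ⊤)
    rw [hentry, hentry, (hΦ.contDiffAt.isSymmSndFDerivAt hsmooth).eq]

end Piola

section ParametricIntegral

variable {E : Type*} [NormedAddCommGroup E] [NormedSpace ℝ E] [ProperSpace E]
  [MeasurableSpace E] [BorelSpace E]

theorem hasDerivAt_setIntegral_of_contDiff {μ : Measure E} [IsFiniteMeasureOnCompacts μ]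
    {Ω : Set E} (hΩ : MeasurableSet Ω) (hΩbdd : Bornology.IsBounded Ω) {F : ℝ → E → ℝ}
    (hF : ContDiff ℝ 1 fun p : ℝ × E => F p.1 p.2) (s₀ : ℝ) :
    HasDerivAt (fun s => ∫ x in Ω, F s x ∂μ) (∫ x in Ω, deriv (fun s => F s x) s₀ ∂μ) s₀ := by
  have hderiv (s : ℝ) (x : E) : HasDerivAt (fun t => F t x)
      (fderiv ℝ (fun p : ℝ × E => F p.1 p.2) (s, x) (1, 0)) s :=
    (hF.differentiable (by simp) (s, x)).hasFDerivAt.comp_hasDerivAt (f := fun t => (t, x)) s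
      ((hasDerivAt_id s).prodMk (hasDerivAt_const s x))
  have hcont : Continuous fun p : ℝ × E =>
      fderiv ℝ (fun p : ℝ × E => F p.1 p.2) p (1, 0) :=
    (hF.continuous_fderiv (by simp)).clm_apply continuous_const
  have hK := hΩbdd.isCompact_closure
  have hfin : μ Ω < ⊤ := (measure_mono subset_closure).trans_lt hK.measure_lt_top
  have hslice {G : ℝ × E → ℝ} (hG : Continuous G) (s : ℝ) :
      IntegrableOn (fun x => G (s, x)) Ω μ :=
    ((hG.comp (Continuous.prodMk_right s)).continuousOn.integrableOn_compact hK).mono_set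
      subset_closure
  obtain ⟨C, hC⟩ := ((isCompact_closedBall s₀ 1).prod hK).exists_bound_of_continuousOn
    hcont.continuousOn
  simp_rw [fun x => (hderiv s₀ x).deriv]
  refine (hasDerivAt_integral_of_dominated_loc_of_deriv_le (bound := fun _ => C)
    (F' := fun s x => fderiv ℝ (fun p : ℝ × E => F p.1 p.2) (s, x) (1, 0))
    (Metric.closedBall_mem_nhds s₀ one_pos)
    (Filter.Eventually.of_forall fun s => (hslice hF.continuous s).aestronglyMeasurable)
    (hslice hF.continuous s₀) (hslice hcont s₀).aestronglyMeasurable ?_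
    (integrableOn_const hfin.ne) (Filter.Eventually.of_forall fun x s _ => hderiv s x)).2
  filter_upwards [ae_restrict_mem hΩ] with x hx s hs
  exact hC (s, x) ⟨hs, subset_closure hx⟩

end ParametricIntegral

/-- Integration by parts against a compactly supported vector field, in coordinates. -/
theorem integral_mul_sum_fderiv_eq_neg {d : ℕ} {y : (Fin d → ℝ) → ℝ}
    {W : Fin d → (Fin d → ℝ) → ℝ} (hy : ContDiff ℝ 1 y) (hW : ∀ j, ContDiff ℝ 1 (W j))
    (hWsupp : ∀ j, HasCompactSupport (W j)) :
    ∫ x, y x * ∑ j, fderiv ℝ (W j) x (Pi.single j 1) =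
      -∫ x, ∑ j, fderiv ℝ y x (Pi.single j 1) * W j x := by
  have hderiv {f : (Fin d → ℝ) → ℝ} (hf : ContDiff ℝ 1 f) (v : Fin d → ℝ) :
      Continuous fun x => fderiv ℝ f x v :=
    (hf.continuous_fderiv (by simp)).clm_apply continuous_const
  have hleft (j : Fin d) : Integrable fun x => y x * fderiv ℝ (W j) x (Pi.single j 1) :=
    (hy.continuous.mul (hderiv (hW j) _)).integrable_of_hasCompactSupport
      ((hWsupp j).fderiv_apply ℝ _).mul_left
  have hright (j : Fin d) : Integrable fun x => fderiv ℝ y x (Pi.single j 1) * W j x :=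
    ((hderiv hy _).mul (hW j).continuous).integrable_of_hasCompactSupport (hWsupp j).mul_left
  simp_rw [Finset.mul_sum]
  rw [integral_finsetSum _ fun j _ => hleft j, integral_finsetSum _ fun j _ => hright j,
    ← Finset.sum_neg_distrib]
  refine Finset.sum_congr rfl fun j _ => ?_
  exact integral_mul_fderiv_eq_neg_fderiv_mul_of_integrable (hright j) (hleft j)
    ((hy.continuous.mul (hW j).continuous).integrable_of_hasCompactSupport (hWsupp j).mul_left)
    (fun x _ => hy.differentiable (by simp) x) (fun x _ => (hW j).differentiable (by simp) x)

section Variation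

variable {d : ℕ} {Φ ψ : (Fin d → ℝ) → (Fin d → ℝ)} {lam : (Fin d → ℝ) → ℝ}

theorem jacobianMatrix_add_smul {x : Fin d → ℝ} (hΦ : DifferentiableAt ℝ Φ x)
    (hψ : DifferentiableAt ℝ ψ x) (s : ℝ) :
    jacobianMatrix (fun z => Φ z + s • ψ z) x = jacobianMatrix Φ x + s • jacobianMatrix ψ x := by
  ext i j
  have h := (hΦ.hasFDerivAt.add (hψ.hasFDerivAt.const_smul s)).fderiv
  exact congrArg (fun L : (Fin d → ℝ) →L[ℝ] (Fin d → ℝ) => L (Pi.single j 1) i) h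

theorem jacobianMatrix_mulVec (x v : Fin d → ℝ) : jacobianMatrix Φ x *ᵥ v = fderiv ℝ Φ x v := by
  conv_rhs => rw [pi_eq_sum_univ' v, map_sum]
  ext i
  simp [mulVec, dotProduct, jacobianMatrix, mul_comm]

/-- The vector field `(λ ∘ Φ) · adj(DΦ) ψ` has divergence equal to the derivative at `s = 0` of
`(λ ∘ (Φ + s ψ)) · det D(Φ + s ψ)`. -/
theorem hasDerivAt_comp_mul_det_jacobianMatrix (hΦ : ContDiff ℝ (⊤ : ℕ∞) Φ)
    (hlam : ContDiff ℝ (⊤ : ℕ∞) lam) (hψ : ContDiff ℝ (⊤ : ℕ∞) ψ) (x : Fin d → ℝ) :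
    HasDerivAt
      (fun s : ℝ => lam (Φ x + s • ψ x) * (jacobianMatrix Φ x + s • jacobianMatrix ψ x).det)
      (∑ j, fderiv ℝ (fun z => lam (Φ z) * ((jacobianMatrix Φ z).adjugate *ᵥ ψ z) j) x
        (Pi.single j 1)) 0 := by
  have hΦx : DifferentiableAt ℝ Φ x := hΦ.differentiable (by simp) x
  have hlamx : HasFDerivAt lam (fderiv ℝ lam (Φ x)) (Φ x) :=
    (hlam.differentiable (by simp) _).hasFDerivAt
  have hadj (j i : Fin d) :
      DifferentiableAt ℝ (fun z => (jacobianMatrix Φ z).adjugate j i) x :=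
    (contDiff_adjugate_apply (contDiff_jacobianMatrix_apply hΦ) j i).differentiable (by simp) x
  have hψx (i : Fin d) :
      HasFDerivAt (fun z => ψ z i) (.proj i ∘L fderiv ℝ ψ x) x :=
    hasFDerivAt_pi'.1 (hψ.differentiable (by simp) x).hasFDerivAt i
  have hfield (j : Fin d) : fderiv ℝ
      (fun z => lam (Φ z) * ((jacobianMatrix Φ z).adjugate *ᵥ ψ z) j) x (Pi.single j 1) =
      fderiv ℝ lam (Φ x) (fderiv ℝ Φ x (Pi.single j 1)) *
        ((jacobianMatrix Φ x).adjugate *ᵥ ψ x) j +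
      lam (Φ x) * ∑ i, ((jacobianMatrix Φ x).adjugate j i * jacobianMatrix ψ x i j +
        ψ x i * fderiv ℝ (fun z => (jacobianMatrix Φ z).adjugate j i) x (Pi.single j 1)) := by
    have h := (hlamx.comp x hΦx.hasFDerivAt).mul
      (HasFDerivAt.fun_sum (u := Finset.univ) fun i _ => (hadj j i).hasFDerivAt.mul (hψx i))
    refine (congrArg (· (Pi.single j 1)) h.fderiv).trans ?_
    simp [jacobianMatrix, mulVec, dotProduct]
    ring
  have hcurve : HasDerivAt (fun s : ℝ => Φ x + s • ψ x) (ψ x) 0 := by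
    simpa using ((hasDerivAt_id (0 : ℝ)).smul_const (ψ x)).const_add (Φ x)
  have hmain := (HasFDerivAt.comp_hasDerivAt (0 : ℝ) (by simpa using hlamx) hcurve).mul
    (hasDerivAt_det_add_smul (jacobianMatrix Φ x) (jacobianMatrix ψ x))
  refine hmain.congr_deriv ?_
  have htransport : ∑ j, fderiv ℝ lam (Φ x) (fderiv ℝ Φ x (Pi.single j 1)) *
      ((jacobianMatrix Φ x).adjugate *ᵥ ψ x) j =
      fderiv ℝ lam (Φ x) (ψ x) * (jacobianMatrix Φ x).det := by
    have h : fderiv ℝ Φ x ((jacobianMatrix Φ x).adjugate *ᵥ ψ x) =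
        (jacobianMatrix Φ x).det • ψ x := by
      rw [← jacobianMatrix_mulVec, mulVec_mulVec, mul_adjugate, smul_mulVec, one_mulVec]
    rw [mul_comm, ← smul_eq_mul, ← map_smul, ← h]
    conv_rhs => rw [pi_eq_sum_univ' ((jacobianMatrix Φ x).adjugate *ᵥ ψ x), map_sum, map_sum]
    simp [mul_comm]
  have hpiola : ∑ j, ∑ i, ψ x i *
      fderiv ℝ (fun z => (jacobianMatrix Φ z).adjugate j i) x (Pi.single j 1) = 0 := by
    rw [Finset.sum_comm]
    simp_rw [← Finset.mul_sum, sum_fderiv_adjugate_jacobianMatrix hΦ x, mul_zero,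
      Finset.sum_const_zero]
  simp_rw [hfield, Finset.sum_add_distrib, htransport, ← Finset.mul_sum, Finset.sum_add_distrib,
    hpiola, add_zero, det_updateRow_eq_sum_adjugate]
  rw [Finset.sum_comm (γ := Fin d)]
  simp

end Variation

/-- **Variation of a transported integral with respect to the transformation**
(interior version of Lemma 3.2). For smooth `Φ, y, λ` with `DΦ` invertible on `closure Ω`
and `ψ` smooth, compactly supported in `Ω`,
`d/ds |₀ ∫_Ω y · (λ ∘ (Φ + sψ)) · det D(Φ + sψ) = -∫_Ω det DΦ ⟨(DΦ)⁻ᵀ ∇y, ψ⟩ (λ ∘ Φ)`. -/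
theorem transported_integral_variation (d : ℕ)
    (Ω : Set (Fin d → ℝ)) (hΩopen : IsOpen Ω) (hΩbdd : Bornology.IsBounded Ω)
    (Φ : (Fin d → ℝ) → (Fin d → ℝ)) (hΦ : ContDiff ℝ (⊤ : ℕ∞) Φ)
    (y lam : (Fin d → ℝ) → ℝ) (hy : ContDiff ℝ (⊤ : ℕ∞) y) (hlam : ContDiff ℝ (⊤ : ℕ∞) lam)
    (hinv : ∀ x ∈ closure Ω, IsUnit (jacobianMatrix Φ x))
    (ψ : (Fin d → ℝ) → (Fin d → ℝ)) (hψ : ContDiff ℝ (⊤ : ℕ∞) ψ)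
    (hψsupp : HasCompactSupport ψ) (hψΩ : tsupport ψ ⊆ Ω) :
    HasDerivAt
      (fun s : ℝ => ∫ x in Ω,
        y x * lam (Φ x + s • ψ x) *
          (jacobianMatrix (fun z => Φ z + s • ψ z) x).det)
      (-∫ x in Ω,
        (jacobianMatrix Φ x).det *
          (∑ i, (((jacobianMatrix Φ x)⁻¹)ᵀ).mulVec (grad y x) i * ψ x i) *
          lam (Φ x))
      0 := by
  have hJΦ := contDiff_jacobianMatrix_apply hΦ
  have hJψ := contDiff_jacobianMatrix_apply hψ
  set W : Fin d → (Fin d → ℝ) → ℝ :=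
    fun j z => lam (Φ z) * ((jacobianMatrix Φ z).adjugate *ᵥ ψ z) j with hWdef
  have hW (j : Fin d) : ContDiff ℝ (⊤ : ℕ∞) (W j) :=
    (hlam.comp hΦ).mul <| ContDiff.sum (s := Finset.univ) fun i _ =>
      (contDiff_adjugate_apply hJΦ j i).mul (contDiff_pi.1 hψ i)
  have hWzero (j : Fin d) (x : Fin d → ℝ) (hx : ψ x = 0) : W j x = 0 := by
    simp [hWdef, hx]
  have hWsupp (j : Fin d) : tsupport (W j) ⊆ tsupport ψ :=
    closure_mono fun x hx hψx => hx (hWzero j x hψx)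
  have hdet (s : ℝ) (x : Fin d → ℝ) : jacobianMatrix (fun z => Φ z + s • ψ z) x =
      jacobianMatrix Φ x + s • jacobianMatrix ψ x :=
    jacobianMatrix_add_smul (hΦ.differentiable (by simp) x) (hψ.differentiable (by simp) x) s
  have hsmooth : ContDiff ℝ (⊤ : ℕ∞) fun p : ℝ × (Fin d → ℝ) =>
      y p.2 * lam (Φ p.2 + p.1 • ψ p.2) *
        (jacobianMatrix Φ p.2 + p.1 • jacobianMatrix ψ p.2).det := by
    refine ((hy.comp contDiff_snd).mul (hlam.comp ?_)).mul (contDiff_det fun i j => ?_)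
    · exact (hΦ.comp contDiff_snd).add (contDiff_fst.smul (hψ.comp contDiff_snd))
    · exact ((hJΦ i j).comp contDiff_snd).add (contDiff_fst.mul ((hJψ i j).comp contDiff_snd))
  simp_rw [hdet]
  refine (hasDerivAt_setIntegral_of_contDiff hΩopen.measurableSet hΩbdd
    (hsmooth.of_le (by simp)) 0).congr_deriv ?_
  have hleft (x : Fin d → ℝ) : deriv (fun s : ℝ => y x * lam (Φ x + s • ψ x) *
      (jacobianMatrix Φ x + s • jacobianMatrix ψ x).det) 0 =
      y x * ∑ j, fderiv ℝ (W j) x (Pi.single j 1) := by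
    simp_rw [mul_assoc]
    exact ((hasDerivAt_comp_mul_det_jacobianMatrix hΦ hlam hψ x).const_mul (y x)).deriv
  have hright (x : Fin d → ℝ) (hx : x ∈ Ω) : (jacobianMatrix Φ x).det *
      (∑ i, (((jacobianMatrix Φ x)⁻¹)ᵀ).mulVec (grad y x) i * ψ x i) * lam (Φ x) =
      ∑ j, fderiv ℝ y x (Pi.single j 1) * W j x := by
    have hunit := (isUnit_iff_isUnit_det _).1 (hinv x (subset_closure hx))
    have hadj : (jacobianMatrix Φ x).adjugate =
        (jacobianMatrix Φ x).det • (jacobianMatrix Φ x)⁻¹ := by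
      rw [inv_def, smul_smul, Ring.mul_inverse_cancel _ hunit, one_smul]
    change _ * ((((jacobianMatrix Φ x)⁻¹)ᵀ *ᵥ grad y x) ⬝ᵥ ψ x) * _ = _
    rw [mulVec_transpose, ← dotProduct_mulVec]
    simp only [hWdef, hadj, smul_mulVec, Pi.smul_apply, smul_eq_mul, dotProduct, grad,
      Finset.mul_sum, Finset.sum_mul]
    exact Finset.sum_congr rfl fun j _ => by ring
  simp_rw [hleft]
  rw [setIntegral_congr_fun hΩopen.measurableSet hright,
    setIntegral_eq_integral_of_forall_compl_eq_zero,
    setIntegral_eq_integral_of_forall_compl_eq_zero]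
  · exact integral_mul_sum_fderiv_eq_neg (hy.of_le (by simp)) (fun j => (hW j).of_le (by simp))
      fun j => hψsupp.of_isClosed_subset (isClosed_tsupport _) (hWsupp j)
  · intro x hx
    refine Finset.sum_eq_zero fun j _ => ?_
    rw [hWzero j x (image_eq_zero_of_notMem_tsupport fun h => hx (hψΩ h)), mul_zero]
  · intro x hx
    have hzero (j : Fin d) : fderiv ℝ (W j) x = 0 :=
      image_eq_zero_of_notMem_tsupport fun h =>
        hx (hψΩ (hWsupp j (tsupport_fderiv_subset ℝ h)))
    simp [hzero]
end

section
/- Variation with respect to the state of a pushed-forward integral (interior version of Theorem 3.3 / Corollary 3.4(ii)): Let Ω ⊆ ℝ^d be a bounded open set, let F : ℝ → ℝ^d, y : ℝ^d → ℝ, φ : ℝ^d → ℝ, λ : ℝ^d → ℝ be C^∞ maps, and let ψ : ℝ^d → ℝ be a C^∞ map with compact support contained in Ω. For τ > 0 and a C^∞ function z : ℝ^d → ℝ define Φ_τ[z] : ℝ^d → ℝ^d by Φ_τ[z](x) = x + τ·F(z(x)), and define K_τ(z) = ∫_Ω φ(x) · λ(Φ_τ[z](x)) · det(DΦ_τ[z](x))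 dx. Then there exist constants C > 0 and τ₀ > 0 such that for every τ with 0 < τ < τ₀: the function s ↦ K_τ(y + s·ψ) is differentiable at s = 0, and | (d/ds)|_{s=0} K_τ(y + s·ψ) + τ · ∫_Ω λ(Φ_τ[y](x)) · ⟨∇φ(x), F'(y(x))⟩ · ψ(x) dx | ≤ C·τ². -/
open Matrix MeasureTheory

/-- The chain rule for a curve composed with a scalar function. -/
theorem HasDerivAt.hasFDerivAt_curve_comp {E G : Type*} [NormedAddCommGroup E] [NormedSpace ℝ E]
    [NormedAddCommGroup G] [NormedSpace ℝ G] {F : ℝ → G} {F' : G} {z : E → ℝ} {z' : E →L[ℝ] ℝ}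
    {x : E} (hF : HasDerivAt F F' (z x)) (hz : HasFDerivAt z z' x) :
    HasFDerivAt (fun v => F (z v)) (z'.smulRight F') x := by
  refine (hF.hasFDerivAt.comp x hz).congr_fderiv ?_
  ext v
  simp

/-- The matrix determinant lemma for the Jacobian of the rank-one perturbation `Id + τ F(z)` of
the identity. -/
theorem det_jacobianMatrix_id_add_smul_comp {d : ℕ} {F : ℝ → (Fin d → ℝ)}
    {z : (Fin d → ℝ) → ℝ} {x : Fin d → ℝ} (τ : ℝ) (hF : DifferentiableAt ℝ F (z x))
    (hz : DifferentiableAt ℝ z x) :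
    (jacobianMatrix (fun v => v + τ • F (z v)) x).det =
      1 + τ * ∑ i, deriv F (z x) i * grad z x i := by
  have hderiv : HasFDerivAt (fun v => v + τ • F (z v))
      (ContinuousLinearMap.id ℝ (Fin d → ℝ) +
        τ • (fderiv ℝ z x).smulRight (deriv F (z x))) x :=
    (hasFDerivAt_id x).add ((hF.hasDerivAt.hasFDerivAt_curve_comp hz.hasFDerivAt).const_smul τ)
  have hmat : jacobianMatrix (fun v => v + τ • F (z v)) x =
      1 + replicateCol Unit (τ • deriv F (z x)) * replicateRow Unit (grad z x) := by
    ext i j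
    simp only [jacobianMatrix, hderiv.fderiv, grad, Matrix.of_apply, Matrix.add_apply,
      Matrix.mul_apply, Finset.univ_unique, Finset.sum_const, Finset.card_singleton, one_smul,
      replicateCol_apply, replicateRow_apply, _root_.add_apply,
      _root_.smul_apply, ContinuousLinearMap.smulRight_apply,
      ContinuousLinearMap.id_apply, Pi.add_apply, Pi.smul_apply, smul_eq_mul, Matrix.one_apply,
      Pi.single_apply]
    ring
  rw [hmat, det_one_add_replicateCol_mul_replicateRow, dotProduct, Finset.mul_sum]
  congr 1
  refine Finset.sum_congr rfl fun i _ => ?_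
  simp only [Pi.smul_apply, smul_eq_mul]
  ring

/-- Differentiation under the integral sign over a bounded set for a jointly `C^1` integrand. -/
theorem hasDerivAt_setIntegral_of_contDiff_s6 {E : Type*} [NormedAddCommGroup E] [NormedSpace ℝ E]
    [ProperSpace E] [MeasurableSpace E] [BorelSpace E] {μ : Measure E}
    [IsFiniteMeasureOnCompacts μ] {s : Set E} (hs : Bornology.IsBounded s)
    {g : ℝ × E → ℝ} (hg : ContDiff ℝ 1 g) (t₀ : ℝ) :
    HasDerivAt (fun t => ∫ x in s, g (t, x) ∂μ)
      (∫ x in s, fderiv ℝ g (t₀, x) (1, 0) ∂μ) t₀ := by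
  have hK : IsCompact (closure s) := hs.isCompact_closure
  have hg' : Continuous fun p => fderiv ℝ g p (1, 0) :=
    (hg.continuous_fderiv one_ne_zero).clm_apply continuous_const
  have hint {f : E → ℝ} (hf : Continuous f) : Integrable f (μ.restrict s) :=
    (hf.continuousOn.integrableOn_compact hK).mono_set subset_closure
  have hslice (t : ℝ) {f : ℝ × E → ℝ} (hf : Continuous f) : Continuous fun x => f (t, x) := by
    fun_prop
  obtain ⟨C, hC⟩ := ((isCompact_closedBall t₀ 1).prod hK).exists_bound_of_continuousOn
    hg'.continuousOn
  have hfin : Integrable (fun _ : E => C) (μ.restrict s) := hint continuous_const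
  refine (hasDerivAt_integral_of_dominated_loc_of_deriv_le (bound := fun _ => C)
    (F' := fun t x => fderiv ℝ g (t, x) (1, 0)) (Metric.closedBall_mem_nhds t₀ one_pos)
    (.of_forall fun t => (hint (hslice t hg.continuous)).aestronglyMeasurable)
    (hint (hslice t₀ hg.continuous)) (hint (hslice t₀ hg')).aestronglyMeasurable ?_ hfin
    (.of_forall fun x t _ => ?_)).2
  · have hmem : ∀ᵐ x ∂μ.restrict s, x ∈ closure s :=
      ae_restrict_of_ae_restrict_of_subset subset_closure
        (ae_restrict_mem isClosed_closure.measurableSet)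
    filter_upwards [hmem] with x hx t ht
    exact hC (t, x) ⟨ht, hx⟩
  · exact ((hg.differentiable one_ne_zero) (t, x)).hasFDerivAt.comp_hasDerivAt t
      ((hasDerivAt_id t).prodMk (hasDerivAt_const t x))

/-- The divergence theorem for the compactly supported vector field `ψ w`. -/
theorem integral_mul_divergence_add_grad_eq_zero {d : ℕ} {ψ : (Fin d → ℝ) → ℝ}
    {w : (Fin d → ℝ) → (Fin d → ℝ)} (hψ : ContDiff ℝ 1 ψ) (hψsupp : HasCompactSupport ψ)
    (hw : ContDiff ℝ 1 w) :
    ∫ x, ∑ i, (ψ x * fderiv ℝ w x (Pi.single i 1) i + grad ψ x i * w x i) = 0 := by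
  have hwi (i : Fin d) : ContDiff ℝ 1 fun x => w x i := contDiff_pi.1 hw i
  have hψ' (i : Fin d) : Continuous fun x => grad ψ x i :=
    (hψ.continuous_fderiv one_ne_zero).clm_apply continuous_const
  have hwi' (i : Fin d) : Continuous fun x => fderiv ℝ (fun v => w v i) x (Pi.single i 1) :=
    ((hwi i).continuous_fderiv one_ne_zero).clm_apply continuous_const
  have hcoord (i : Fin d) (x : Fin d → ℝ) :
      fderiv ℝ w x (Pi.single i 1) i = fderiv ℝ (fun v => w v i) x (Pi.single i 1) := by
    rw [fderiv_apply (hw.differentiable one_ne_zero x) i]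
    rfl
  simp only [hcoord]
  have hint₁ (i : Fin d) :
      Integrable fun x => ψ x * fderiv ℝ (fun v => w v i) x (Pi.single i 1) :=
    (hψ.continuous.mul (hwi' i)).integrable_of_hasCompactSupport hψsupp.mul_right
  have hint₂ (i : Fin d) : Integrable fun x => grad ψ x i * w x i :=
    ((hψ' i).mul (hwi i).continuous).integrable_of_hasCompactSupport
      (hψsupp.fderiv_apply ℝ (Pi.single i 1)).mul_right
  have hint₃ (i : Fin d) : Integrable fun x => ψ x * w x i :=
    (hψ.continuous.mul (hwi i).continuous).integrable_of_hasCompactSupport hψsupp.mul_right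
  rw [integral_finsetSum _ fun i _ => by exact (hint₁ i).add (hint₂ i)]
  refine Finset.sum_eq_zero fun i _ => ?_
  rw [integral_add (hint₁ i) (hint₂ i),
    integral_mul_fderiv_eq_neg_fderiv_mul_of_integrable (hint₂ i) (hint₁ i) (hint₃ i)
      (fun x _ => hψ.differentiable one_ne_zero x)
      (fun x _ => (hwi i).differentiable one_ne_zero x)]
  exact neg_add_cancel _

/-- The `s`-derivative of the integrand `φ (λ ∘ Φ_τ) det DΦ_τ` along `y + s ψ` equals `τ` times the
divergence of the field `ψ φ (λ ∘ Φ_τ) F'(y)`, minus `τ (λ ∘ Φ_τ) ⟨∇φ, F'(y)⟩ ψ`. -/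
theorem hasDerivAt_pushforward_integrand {d : ℕ} {F : ℝ → (Fin d → ℝ)} (hF : ContDiff ℝ 2 F)
    {y φ lam ψ : (Fin d → ℝ) → ℝ} (hy : Differentiable ℝ y) (hφ : Differentiable ℝ φ)
    (hlam : Differentiable ℝ lam) (τ : ℝ) (x : Fin d → ℝ) :
    HasDerivAt
      (fun s : ℝ => φ x * lam (x + τ • F (y x + s * ψ x)) *
        (1 + τ * ∑ i, deriv F (y x + s * ψ x) i * (grad y x i + s * grad ψ x i)))
      (τ * (∑ i, (ψ x * fderiv ℝ
            (fun v => (φ v * lam (v + τ • F (y v))) • deriv F (y v)) x (Pi.single i 1) i +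
          grad ψ x i * ((φ x * lam (x + τ • F (y x))) • deriv F (y x)) i)) -
        τ * (lam (x + τ • F (y x)) * (∑ i, grad φ x i * deriv F (y x) i) * ψ x)) 0 := by
  have hFd : Differentiable ℝ F := hF.differentiable two_ne_zero
  have hF'd : Differentiable ℝ (deriv F) :=
    ((contDiff_succ_iff_deriv (n := 1)).1 hF).2.2.differentiable one_ne_zero
  set p := x + τ • F (y x) with hp
  set L := fderiv ℝ lam p
  have hsum : ∑ i, deriv F (y x) i * L (Pi.single i 1) = L (deriv F (y x)) := by
    conv_rhs => rw [pi_eq_sum_univ' (deriv F (y x))]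
    simp
  have hline : HasDerivAt (fun s : ℝ => y x + s * ψ x) (ψ x) 0 := by
    simpa using ((hasDerivAt_id (0 : ℝ)).mul_const (ψ x)).const_add (y x)
  have hy0 : y x + 0 * ψ x = y x := by ring
  have hFs : HasDerivAt (fun s : ℝ => F (y x + s * ψ x)) (ψ x • deriv F (y x)) 0 :=
    HasDerivAt.scomp (g₁ := F) (0 : ℝ) (by rw [hy0]; exact (hFd _).hasDerivAt) hline
  have hF's : HasDerivAt (fun s : ℝ => deriv F (y x + s * ψ x))
      (ψ x • deriv (deriv F) (y x)) 0 :=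
    HasDerivAt.scomp (g₁ := deriv F) (0 : ℝ) (by rw [hy0]; exact (hF'd _).hasDerivAt) hline
  have hlams : HasDerivAt (fun s : ℝ => lam (x + τ • F (y x + s * ψ x)))
      (L (τ • ψ x • deriv F (y x))) 0 :=
    HasFDerivAt.comp_hasDerivAt (l := lam) (0 : ℝ) (by rw [hy0]; exact (hlam _).hasFDerivAt)
      ((hFs.const_smul τ).const_add x)
  have hgrads (i : Fin d) :
      HasDerivAt (fun s : ℝ => grad y x i + s * grad ψ x i) (grad ψ x i) 0 := by
    simpa using ((hasDerivAt_id (0 : ℝ)).mul_const (grad ψ x i)).const_add (grad y x i)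
  have hdet := ((HasDerivAt.fun_sum (u := Finset.univ) fun i _ =>
    (hasDerivAt_pi.1 hF's i).mul (hgrads i)).const_mul τ).const_add 1
  have hprod := (hlams.const_mul (φ x)).mul hdet
  have hΦ : HasFDerivAt (fun v => lam (v + τ • F (y v)))
      (L.comp (ContinuousLinearMap.id ℝ (Fin d → ℝ) +
        τ • (fderiv ℝ y x).smulRight (deriv F (y x)))) x :=
    HasFDerivAt.comp (g := lam) x (hlam p).hasFDerivAt ((hasFDerivAt_id x).add
      (((hFd _).hasDerivAt.hasFDerivAt_curve_comp (hy x).hasFDerivAt).const_smul τ))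
  have hw := ((hφ x).hasFDerivAt.mul hΦ).smul
    ((hF'd _).hasDerivAt.hasFDerivAt_curve_comp (hy x).hasFDerivAt)
  refine hprod.congr_deriv ?_
  have hw' : fderiv ℝ (fun v => (φ v * lam (v + τ • F (y v))) • deriv F (y v)) x = _ := hw.fderiv
  rw [hw']
  simp only [Pi.mul_apply, Pi.smul_apply, smul_eq_mul, map_smul, zero_mul, add_zero, ← hp,
    _root_.add_apply, _root_.smul_apply, ContinuousLinearMap.smulRight_apply,
    ContinuousLinearMap.comp_apply, ContinuousLinearMap.id_apply, map_add, Pi.add_apply]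
  have hdivsum : ∑ i, (ψ x * (φ x * lam p *
          (fderiv ℝ y x (Pi.single i 1) * deriv (deriv F) (y x) i) +
        (φ x * (L (Pi.single i 1) + τ * (fderiv ℝ y x (Pi.single i 1) * L (deriv F (y x)))) +
          lam p * fderiv ℝ φ x (Pi.single i 1)) * deriv F (y x) i) +
        grad ψ x i * (φ x * lam p * deriv F (y x) i)) =
      φ x * lam p * (∑ i, (ψ x * deriv (deriv F) (y x) i * grad y x i +
        deriv F (y x) i * grad ψ x i)) +
      ψ x * φ x * (∑ i, deriv F (y x) i * L (Pi.single i 1)) +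
      ψ x * φ x * τ * L (deriv F (y x)) * (∑ i, deriv F (y x) i * grad y x i) +
      lam p * ψ x * ∑ i, grad φ x i * deriv F (y x) i := by
    simp only [Finset.mul_sum, ← Finset.sum_add_distrib]
    refine Finset.sum_congr rfl fun i _ => ?_
    simp only [grad]
    ring
  rw [hdivsum, hsum]
  ring

/-- **Variation with respect to the state of a pushed-forward integral** (interior version of
Theorem 3.3 / Corollary 3.4(ii)). With `Φ_τ[z] = Id + τ F(z)` and
`K_τ(z) = ∫_Ω φ · (λ ∘ Φ_τ[z]) · det DΦ_τ[z]`, for all small `τ > 0` the map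
`s ↦ K_τ(y + sψ)` is differentiable at `0` and its derivative equals
`-τ ∫_Ω (λ ∘ Φ_τ[y]) ⟨∇φ, F'(y)⟩ ψ` up to an error of order `τ²`, uniformly in `τ`. -/
theorem pushed_forward_integral_state_variation (d : ℕ)
    (Ω : Set (Fin d → ℝ)) (hΩopen : IsOpen Ω) (hΩbdd : Bornology.IsBounded Ω)
    (F : ℝ → (Fin d → ℝ)) (hF : ContDiff ℝ (⊤ : ℕ∞) F)
    (y φ lam : (Fin d → ℝ) → ℝ)
    (hy : ContDiff ℝ (⊤ : ℕ∞) y) (hφ : ContDiff ℝ (⊤ : ℕ∞) φ) (hlam : ContDiff ℝ (⊤ : ℕ∞) lam)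
    (ψ : (Fin d → ℝ) → ℝ) (hψ : ContDiff ℝ (⊤ : ℕ∞) ψ)
    (hψsupp : HasCompactSupport ψ) (hψΩ : tsupport ψ ⊆ Ω) :
    ∃ C > (0 : ℝ), ∃ τ₀ > (0 : ℝ), ∀ τ : ℝ, 0 < τ → τ < τ₀ →
      ∃ D : ℝ,
        HasDerivAt
          (fun s : ℝ => ∫ x in Ω,
            φ x * lam (x + τ • F (y x + s * ψ x)) *
              (jacobianMatrix (fun v => v + τ • F (y v + s * ψ v)) x).det)
          D 0 ∧
        |D + τ * ∫ x in Ω,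
            lam (x + τ • F (y x)) * (∑ i, grad φ x i * deriv F (y x) i) * ψ x|
          ≤ C * τ ^ 2 := by
  refine ⟨1, one_pos, 1, one_pos, fun τ _ _ => ?_⟩
  have hsmooth {E : Type} [NormedAddCommGroup E] [NormedSpace ℝ E] {E' : Type}
      [NormedAddCommGroup E'] [NormedSpace ℝ E'] {f : E → E'} (n : ℕ)
      (hf : ContDiff ℝ (⊤ : ℕ∞) f) : ContDiff ℝ n f := hf.of_le (by exact_mod_cast le_top)
  have hF2 : ContDiff ℝ 2 F := hsmooth 2 hF
  have hF' : ContDiff ℝ 1 (deriv F) := ((contDiff_succ_iff_deriv (n := 1)).1 hF2).2.2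
  have hF1 : ContDiff ℝ 1 F := hsmooth 1 hF
  have hy1 : ContDiff ℝ 1 y := hsmooth 1 hy
  have hφ1 : ContDiff ℝ 1 φ := hsmooth 1 hφ
  have hlam1 : ContDiff ℝ 1 lam := hsmooth 1 hlam
  have hψ1 : ContDiff ℝ 1 ψ := hsmooth 1 hψ
  have hgrad {f : (Fin d → ℝ) → ℝ} (hf : ContDiff ℝ (⊤ : ℕ∞) f) (i : Fin d) :
      ContDiff ℝ 1 fun x => grad f x i :=
    ((hsmooth 2 hf).fderiv_right (m := 1) (by norm_num)).clm_apply contDiff_const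
  have hF'i (i : Fin d) : ContDiff ℝ 1 fun t => deriv F t i := contDiff_pi.1 hF' i
  have hgy := hgrad hy
  have hgψ := hgrad hψ
  let g : ℝ × (Fin d → ℝ) → ℝ := fun p =>
    φ p.2 * lam (p.2 + τ • F (y p.2 + p.1 * ψ p.2)) *
      (1 + τ * ∑ i, deriv F (y p.2 + p.1 * ψ p.2) i * (grad y p.2 i + p.1 * grad ψ p.2 i))
  have hz : ContDiff ℝ 1 fun p : ℝ × (Fin d → ℝ) => y p.2 + p.1 * ψ p.2 := by fun_prop
  have hg : ContDiff ℝ 1 g := by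
    unfold g
    fun_prop
  have hintegrand (s : ℝ) (x : Fin d → ℝ) :
      φ x * lam (x + τ • F (y x + s * ψ x)) *
        (jacobianMatrix (fun v => v + τ • F (y v + s * ψ v)) x).det = g (s, x) := by
    have hyx := hy1.differentiable one_ne_zero x
    have hψx := hψ1.differentiable one_ne_zero x
    have hgr (i : Fin d) :
        grad (fun v => y v + s * ψ v) x i = grad y x i + s * grad ψ x i := by
      simp only [grad]
      rw [fderiv_fun_add hyx (hψx.const_mul s), fderiv_const_mul hψx]
      rfl
    rw [det_jacobianMatrix_id_add_smul_comp (z := fun v => y v + s * ψ v) τ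
      (hF1.differentiable one_ne_zero _) (hyx.add (hψx.const_mul s))]
    simp only [hgr, g]
  let w : (Fin d → ℝ) → (Fin d → ℝ) := fun v => (φ v * lam (v + τ • F (y v))) • deriv F (y v)
  have hw : ContDiff ℝ 1 w := by
    unfold w
    fun_prop
  let R : (Fin d → ℝ) → ℝ := fun x =>
    lam (x + τ • F (y x)) * (∑ i, grad φ x i * deriv F (y x) i) * ψ x
  let divψw : (Fin d → ℝ) → ℝ := fun x =>
    ∑ i, (ψ x * fderiv ℝ w x (Pi.single i 1) i + grad ψ x i * w x i)
  have hRcont : Continuous R := by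
    have hgφ := fun i => (hgrad hφ i).continuous
    have hF'c := fun i => (hF'i i).continuous
    have hFc := hF1.continuous
    have hyc := hy1.continuous
    have hlamc := hlam1.continuous
    have hψc := hψ1.continuous
    unfold R
    fun_prop
  have hdivcont : Continuous divψw := by
    refine continuous_finsetSum _ fun i _ => (hψ1.continuous.mul ?_).add
      ((hgψ i).continuous.mul (contDiff_pi.1 hw i).continuous)
    exact (continuous_apply i).comp
      ((hw.continuous_fderiv one_ne_zero).clm_apply continuous_const)
  have hderiv (x : Fin d → ℝ) : fderiv ℝ g (0, x) (1, 0) = τ * divψw x - τ * R x :=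
    HasDerivAt.unique (f := fun s => g (s, x)) (x := 0)
      ((hg.differentiable one_ne_zero (0, x)).hasFDerivAt.comp_hasDerivAt
        (l := g) (0 : ℝ)
        ((hasDerivAt_id (0 : ℝ)).prodMk (hasDerivAt_const (0 : ℝ) x)))
      (hasDerivAt_pushforward_integrand hF2 (hy1.differentiable one_ne_zero)
        (hφ1.differentiable one_ne_zero) (hlam1.differentiable one_ne_zero) τ x (ψ := ψ))
  have hint {f : (Fin d → ℝ) → ℝ} (hf : Continuous f) : IntegrableOn f Ω :=
    (hf.continuousOn.integrableOn_compact hΩbdd.isCompact_closure).mono_set subset_closure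
  have hdiv : ∫ x in Ω, divψw x = 0 := by
    rw [setIntegral_eq_integral_of_forall_compl_eq_zero]
    · exact integral_mul_divergence_add_grad_eq_zero hψ1 hψsupp hw
    · intro x hx
      have hx' : x ∉ tsupport ψ := fun h => hx (hψΩ h)
      simp [divψw, grad, image_eq_zero_of_notMem_tsupport hx',
        fderiv_of_notMem_tsupport (𝕜 := ℝ) hx']
  have hD := hasDerivAt_setIntegral_of_contDiff_s6 (μ := volume) hΩbdd hg 0
  have hval : ∫ x in Ω, fderiv ℝ g (0, x) (1, 0) = -(τ * ∫ x in Ω, R x) := by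
    simp only [hderiv]
    rw [integral_sub ((hint hdivcont).const_mul τ) ((hint hRcont).const_mul τ),
      integral_const_mul, integral_const_mul, hdiv, mul_zero, zero_sub]
  refine ⟨-(τ * ∫ x in Ω, R x), ?_, ?_⟩
  · simp only [hintegrand]
    exact hval ▸ hD
  · change |-(τ * ∫ x in Ω, R x) + τ * ∫ x in Ω, R x| ≤ 1 * τ ^ 2
    rw [neg_add_cancel, abs_zero, one_mul]
    exact sq_nonneg τ
end
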